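/- arXiv:1605.08414 — 3 statements merged into one kernel-verified Lean document; each statement's English description precedes it below -/
import Mathlib

section
/- Let f : [0,∞) → [0,∞) be monotone nondecreasing and for t ≥ 0 set Λ(t) = ∫₀ᵗ e^{-(t-u)} f(u) du. Then ∫₀^∞ e^{-Λ(t)} f(t) dt ≤ e·∫₀^∞ e^{-f(t)} f(t) dt + 2. In particular, if ∫₀^∞ e^{-f(t)} f(t) dt < ∞ then ∫₀^∞ e^{-Λ(t)} f(t) dt < ∞. -/
open MeasureTheory Real

/-- Exponentially discounted average `∫₀ᵗ e^{-(t-u)} g(u) du`, with the factor `e^{-t}` pulled out. -/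
noncomputable def expAverage (g : ℝ → ℝ) (t : ℝ) : ℝ :=
  Real.exp (-t) * ∫ u in (0:ℝ)..t, Real.exp u * g u

lemma expAverage_eq_integral (g : ℝ → ℝ) (t : ℝ) :
    expAverage g t = ∫ u in (0:ℝ)..t, Real.exp (-(t - u)) * g u := by
  rw [expAverage, ← intervalIntegral.integral_const_mul]
  congr 1
  ext u
  rw [← mul_assoc, ← Real.exp_add]
  ring_nf

lemma Monotone.intervalIntegrable_exp_mul {g : ℝ → ℝ} (hg : Monotone g) (a b : ℝ) :
    IntervalIntegrable (fun u => Real.exp u * g u) volume a b :=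
  hg.intervalIntegrable.continuousOn_mul Real.continuous_exp.continuousOn

lemma Monotone.continuous_expAverage {g : ℝ → ℝ} (hg : Monotone g) :
    Continuous (expAverage g) :=
  (Real.continuous_exp.comp continuous_neg).mul
    (intervalIntegral.continuous_primitive hg.intervalIntegrable_exp_mul 0)

lemma Monotone.hasDerivAt_expAverage {g : ℝ → ℝ} (hg : Monotone g) {t : ℝ}
    (ht : ContinuousAt g t) : HasDerivAt (expAverage g) (g t - expAverage g t) t := by
  have hK := intervalIntegral.integral_hasDerivAt_right (hg.intervalIntegrable_exp_mul 0 t)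
    (Real.measurable_exp.mul hg.measurable).stronglyMeasurable.stronglyMeasurableAtFilter
    (Real.continuous_exp.continuousAt.mul ht)
  have h := (hasDerivAt_neg t).exp.mul hK
  refine h.congr_deriv ?_
  have : Real.exp (-t) * Real.exp t = 1 := by rw [← Real.exp_add]; simp
  simp only [expAverage, ← mul_assoc, this]
  ring

lemma expAverage_nonneg {g : ℝ → ℝ} (hg : ∀ t, 0 ≤ g t) {t : ℝ} (ht : 0 ≤ t) :
    0 ≤ expAverage g t :=
  mul_nonneg (Real.exp_nonneg _) <|
    intervalIntegral.integral_nonneg ht fun u _ => mul_nonneg (Real.exp_nonneg _) (hg u)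

lemma Monotone.expAverage_le {g : ℝ → ℝ} (hg : Monotone g) (hg0 : ∀ t, 0 ≤ g t) {t : ℝ}
    (ht : 0 ≤ t) : expAverage g t ≤ g t := by
  have h : ∫ u in (0:ℝ)..t, Real.exp u * g u ≤ ∫ u in (0:ℝ)..t, Real.exp u * g t :=
    intervalIntegral.integral_mono_on ht (hg.intervalIntegrable_exp_mul 0 t)
      ((Real.continuous_exp.mul continuous_const).intervalIntegrable _ _)
      fun u hu => mul_le_mul_of_nonneg_left (hg hu.2) (Real.exp_nonneg _)
  rw [intervalIntegral.integral_mul_const, integral_exp, Real.exp_zero] at h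
  have hexp : Real.exp (-t) * Real.exp t = 1 := by rw [← Real.exp_add]; simp
  calc expAverage g t ≤ Real.exp (-t) * ((Real.exp t - 1) * g t) :=
        mul_le_mul_of_nonneg_left h (Real.exp_nonneg _)
    _ = g t - Real.exp (-t) * g t := by linear_combination g t * hexp
    _ ≤ g t := sub_le_self _ (mul_nonneg (Real.exp_nonneg _) (hg0 t))

lemma exp_neg_mul_le_add {x y : ℝ} (hx : 0 ≤ x) (hxy : x ≤ y) :
    Real.exp (-x) * y ≤
      Real.exp 1 * (Real.exp (-y) * y) + (x + 1) * Real.exp (-x) * (y - x) := by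
  rcases le_total (y - x) 1 with h | h
  · have h1 : Real.exp (-x) ≤ Real.exp 1 * Real.exp (-y) := by
      rw [← Real.exp_add]
      exact Real.exp_le_exp.2 (by linarith)
    have h2 := mul_le_mul_of_nonneg_right h1 (hx.trans hxy)
    have h3 : 0 ≤ (x + 1) * Real.exp (-x) * (y - x) :=
      mul_nonneg (by positivity) (by linarith)
    linarith
  · have h1 : y ≤ (x + 1) * (y - x) := by nlinarith
    have h2 := mul_le_mul_of_nonneg_left h1 (Real.exp_nonneg (-x))
    have h3 : 0 ≤ Real.exp 1 * (Real.exp (-y) * y) :=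
      mul_nonneg (by positivity) (mul_nonneg (by positivity) (hx.trans hxy))
    linarith

lemma hasDerivAt_neg_add_two_mul_exp_neg (x : ℝ) :
    HasDerivAt (fun x => -((x + 2) * Real.exp (-x))) ((x + 1) * Real.exp (-x)) x := by
  refine (((hasDerivAt_id x).add_const 2).mul (hasDerivAt_neg x).exp).neg.congr_deriv ?_
  simp only [id]
  ring

lemma Monotone.lintegral_deriv_expAverage_le {g : ℝ → ℝ} (hg : Monotone g)
    (hg0 : ∀ t, 0 ≤ g t) :
    ∫⁻ t in Set.Ioi (0:ℝ), ENNReal.ofReal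
      ((expAverage g t + 1) * Real.exp (-expAverage g t) * (g t - expAverage g t)) ≤ 2 := by
  set F : ℝ → ℝ := fun t =>
    (expAverage g t + 1) * Real.exp (-expAverage g t) * (g t - expAverage g t) with hF
  have hcont := hg.continuous_expAverage
  have hint (a b : ℝ) : IntervalIntegrable F volume a b :=
    (hg.intervalIntegrable.sub (hcont.intervalIntegrable a b)).continuousOn_mul
      (by fun_prop)
  have hbound (n : ℕ) : ∫⁻ t in Set.Ioc (0:ℝ) n, ENNReal.ofReal (F t) ≤ 2 := by
    have hn : (0:ℝ) ≤ n := n.cast_nonneg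
    have hFnn : 0 ≤ᵐ[volume.restrict (Set.Ioc (0:ℝ) n)] F := by
      filter_upwards [ae_restrict_mem measurableSet_Ioc] with t ht
      have := expAverage_nonneg hg0 ht.1.le
      exact mul_nonneg (by positivity) (sub_nonneg.2 (hg.expAverage_le hg0 ht.1.le))
    rw [← ofReal_integral_eq_lintegral_ofReal (hint 0 n).1 hFnn,
      ← intervalIntegral.integral_of_le hn,
      integral_eq_of_hasDerivAt_off_countable_of_le
        (fun t => -((expAverage g t + 2) * Real.exp (-expAverage g t))) F hn
        hg.countable_not_continuousAt (by fun_prop)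
        (fun t ht => (hasDerivAt_neg_add_two_mul_exp_neg _).comp t
          (hg.hasDerivAt_expAverage (not_not.1 ht.2))) (hint 0 n)]
    refine ENNReal.ofReal_le_of_le_toReal ?_
    have h0 : expAverage g 0 = 0 := by simp [expAverage]
    have := expAverage_nonneg hg0 hn
    have h2 : 0 ≤ (expAverage g n + 2) * Real.exp (-expAverage g n) := by positivity
    simp only [h0, neg_zero, Real.exp_zero, ENNReal.toReal_ofNat]
    linarith
  have hU : Set.Ioi (0:ℝ) = ⋃ n : ℕ, Set.Ioc (0:ℝ) n := by
    ext t
    simp only [Set.mem_Ioi, Set.mem_iUnion, Set.mem_Ioc, exists_and_left]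
    exact ⟨fun h => ⟨h, exists_nat_ge t⟩, And.left⟩
  have hdir : Directed (· ⊆ ·) fun n : ℕ => Set.Ioc (0:ℝ) n :=
    Monotone.directed_le fun m n hmn => Set.Ioc_subset_Ioc_right (Nat.cast_le.2 hmn)
  rw [hU, setLIntegral_iUnion_of_directed _ hdir]
  exact iSup_le hbound

theorem frog_integral_comparison (f Λ : ℝ → ℝ)
    (hf_nonneg : ∀ t, 0 ≤ t → 0 ≤ f t)
    (hf_mono : MonotoneOn f (Set.Ici (0 : ℝ)))
    (hΛ : ∀ t, Λ t = ∫ u in (0:ℝ)..t, Real.exp (-(t - u)) * f u) :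
    (∫⁻ t in Set.Ioi (0:ℝ), ENNReal.ofReal (Real.exp (-Λ t) * f t)) ≤
        ENNReal.ofReal (Real.exp 1) *
          (∫⁻ t in Set.Ioi (0:ℝ), ENNReal.ofReal (Real.exp (-f t) * f t)) + 2 ∧
      ((∫⁻ t in Set.Ioi (0:ℝ), ENNReal.ofReal (Real.exp (-f t) * f t)) < ⊤ →
        (∫⁻ t in Set.Ioi (0:ℝ), ENNReal.ofReal (Real.exp (-Λ t) * f t)) < ⊤) := by
  suffices h : (∫⁻ t in Set.Ioi (0:ℝ), ENNReal.ofReal (Real.exp (-Λ t) * f t)) ≤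
      ENNReal.ofReal (Real.exp 1) *
        (∫⁻ t in Set.Ioi (0:ℝ), ENNReal.ofReal (Real.exp (-f t) * f t)) + 2 from
    ⟨h, fun hfin => h.trans_lt <| ENNReal.add_lt_top.2
      ⟨ENNReal.mul_lt_top ENNReal.ofReal_lt_top hfin, by simp⟩⟩
  let g : ℝ → ℝ := fun t => f (max t 0)
  have hg : Monotone g := fun s t hst =>
    hf_mono (le_max_right s 0) (le_max_right t 0) (max_le_max_right 0 hst)
  have hg0 (t : ℝ) : 0 ≤ g t := hf_nonneg _ (le_max_right t 0)
  have hfg {t : ℝ} (ht : 0 ≤ t) : f t = g t := by simp only [g, max_eq_left ht]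
  have hΛg {t : ℝ} (ht : 0 ≤ t) : Λ t = expAverage g t := by
    rw [hΛ, expAverage_eq_integral]
    refine intervalIntegral.integral_congr fun u hu => ?_
    rw [Set.uIcc_of_le ht] at hu
    simp only [hfg hu.1]
  have hmeas : Measurable fun t => ENNReal.ofReal (Real.exp (-g t) * g t) :=
    ((Real.measurable_exp.comp hg.measurable.neg).mul hg.measurable).ennreal_ofReal
  calc ∫⁻ t in Set.Ioi (0:ℝ), ENNReal.ofReal (Real.exp (-Λ t) * f t)
      ≤ ∫⁻ t in Set.Ioi (0:ℝ), (ENNReal.ofReal (Real.exp 1) *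
          ENNReal.ofReal (Real.exp (-g t) * g t) + ENNReal.ofReal
          ((expAverage g t + 1) * Real.exp (-expAverage g t) * (g t - expAverage g t))) := by
        refine setLIntegral_mono' measurableSet_Ioi fun t ht => ?_
        have ht0 : 0 ≤ t := le_of_lt ht
        have hx := expAverage_nonneg hg0 ht0
        have hxy := hg.expAverage_le hg0 ht0
        rw [hΛg ht0, hfg ht0, ← ENNReal.ofReal_mul (Real.exp_nonneg 1),
          ← ENNReal.ofReal_add]
        · exact ENNReal.ofReal_le_ofReal (exp_neg_mul_le_add hx hxy)
        · have := hg0 t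
          positivity
        · exact mul_nonneg (by positivity) (sub_nonneg.2 hxy)
    _ = ENNReal.ofReal (Real.exp 1) *
          (∫⁻ t in Set.Ioi (0:ℝ), ENNReal.ofReal (Real.exp (-g t) * g t)) +
        ∫⁻ t in Set.Ioi (0:ℝ), ENNReal.ofReal
          ((expAverage g t + 1) * Real.exp (-expAverage g t) * (g t - expAverage g t)) := by
        rw [lintegral_add_left (hmeas.const_mul _), lintegral_const_mul _ hmeas]
    _ ≤ ENNReal.ofReal (Real.exp 1) *
          (∫⁻ t in Set.Ioi (0:ℝ), ENNReal.ofReal (Real.exp (-f t) * f t)) + 2 := by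
        rw [setLIntegral_congr_fun measurableSet_Ioi
          (g := fun t => ENNReal.ofReal (Real.exp (-f t) * f t))
          fun t ht => by simp only [hfg (le_of_lt ht)]]
        gcongr
        exact hg.lintegral_deriv_expAverage_le hg0
end

section
/- Define f : [0,∞) → [0,∞) by f(t) = 1 if t ∈ [2ⁿ, 2ⁿ+1) for some integer n ≥ 1, and f(t) = t otherwise, and for t ≥ 0 set Λ(t) = ∫₀ᵗ e^{-(t-u)} f(u) du. Then Λ(s) ≥ e^{-1}·(s − 2) for all s ≥ 4. -/
open MeasureTheory Real

lemma hasDerivAt_exp_neg_sub (s u : ℝ) :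
    HasDerivAt (fun u => Real.exp (-(s - u))) (Real.exp (-(s - u))) u := by
  have h : HasDerivAt (fun u : ℝ => -(s - u)) 1 u := by
    simp only [neg_sub]
    exact (hasDerivAt_id' u).sub_const s
  simpa only [mul_one] using h.exp

lemma integral_exp_neg_sub (s a b : ℝ) :
    ∫ u in a..b, Real.exp (-(s - u)) = Real.exp (-(s - b)) - Real.exp (-(s - a)) :=
  intervalIntegral.integral_eq_sub_of_hasDerivAt (fun u _ => hasDerivAt_exp_neg_sub s u)
    (Continuous.intervalIntegrable (by fun_prop) _ _)

lemma integral_exp_neg_sub_mul_id (s a b : ℝ) :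
    ∫ u in a..b, Real.exp (-(s - u)) * u
      = Real.exp (-(s - b)) * (b - 1) - Real.exp (-(s - a)) * (a - 1) := by
  refine intervalIntegral.integral_eq_sub_of_hasDerivAt
    (f := fun u => Real.exp (-(s - u)) * (u - 1)) (fun u _ => ?_)
    (Continuous.intervalIntegrable (by fun_prop) _ _)
  exact ((hasDerivAt_exp_neg_sub s u).fun_mul ((hasDerivAt_id' u).sub_const 1)).congr_deriv
    (by ring)

lemma not_mem_dyadic_window {n : ℕ} {u : ℝ} (h1 : (2:ℝ) ^ n + 1 ≤ u) (h2 : u < (2:ℝ) ^ (n + 1)) :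
    ¬ ∃ j : ℕ, 1 ≤ j ∧ (2:ℝ) ^ j ≤ u ∧ u < (2:ℝ) ^ j + 1 := by
  rintro ⟨j, -, h3, h4⟩
  have h5 : n < j := (pow_lt_pow_iff_right₀ (one_lt_two (α := ℝ))).1 (by linarith)
  have h6 : j < n + 1 := (pow_lt_pow_iff_right₀ (one_lt_two (α := ℝ))).1 (by linarith)
  omega

/-- A function equal to `1` on a measurable set and to the identity on the rest of `[0, ∞)` is
integrable against a continuous weight on bounded subintervals of `[0, ∞)`. -/
lemma intervalIntegrable_mul_of_eq_one_or_id {f w : ℝ → ℝ} {S : Set ℝ} (hS : MeasurableSet S)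
    (hf1 : ∀ t ∈ S, f t = 1) (hf2 : ∀ t, 0 ≤ t → t ∉ S → f t = t) (hw : Continuous w)
    {a b : ℝ} (ha : 0 ≤ a) (hb : 0 ≤ b) :
    IntervalIntegrable (fun u => w u * f u) volume a b := by
  have hone : IntervalIntegrable (S.indicator w) volume a b := by
    have h := hw.intervalIntegrable (μ := volume) a b
    exact ⟨h.1.indicator hS, h.2.indicator hS⟩
  have hid : IntervalIntegrable (Sᶜ.indicator fun u => w u * u) volume a b := by
    have h := (hw.mul continuous_id).intervalIntegrable (μ := volume) a b
    exact ⟨h.1.indicator hS.compl, h.2.indicator hS.compl⟩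
  refine (hone.add hid).congr fun u hu => ?_
  have hu0 : 0 ≤ u := (le_min ha hb).trans hu.1.le
  by_cases h : u ∈ S
  · simp [h, hf1 u h]
  · simp [h, hf2 u hu0 h]

/-- For the non-monotone intensity `f` equal to `1` on the intervals `[2ⁿ, 2ⁿ+1)` (`n ≥ 1`)
and equal to `t` elsewhere, with `Λ(t) = ∫₀ᵗ e^{-(t-u)} f(u) du`, one has
`Λ(s) ≥ e^{-1}·(s − 2)` for all `s ≥ 4`. -/
theorem frog_counterexample_lambda_lb (f Λ : ℝ → ℝ)
    (hf1 : ∀ t : ℝ, (∃ n : ℕ, 1 ≤ n ∧ (2:ℝ) ^ n ≤ t ∧ t < (2:ℝ) ^ n + 1) → f t = 1)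
    (hf2 : ∀ t : ℝ, 0 ≤ t → (¬ ∃ n : ℕ, 1 ≤ n ∧ (2:ℝ) ^ n ≤ t ∧ t < (2:ℝ) ^ n + 1) → f t = t)
    (hΛ : ∀ t, Λ t = ∫ u in (0:ℝ)..t, Real.exp (-(t - u)) * f u) :
    ∀ s : ℝ, 4 ≤ s → Real.exp (-1) * (s - 2) ≤ Λ s := by
  intro s hs
  have hS : MeasurableSet {t : ℝ | ∃ n : ℕ, 1 ≤ n ∧ (2:ℝ) ^ n ≤ t ∧ t < (2:ℝ) ^ n + 1} := by
    measurability
  have hint : ∀ a b : ℝ, 0 ≤ a → 0 ≤ b →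
      IntervalIntegrable (fun u => Real.exp (-(s - u)) * f u) volume a b := fun a b ha hb =>
    intervalIntegrable_mul_of_eq_one_or_id hS hf1 hf2 (by fun_prop) ha hb
  have hnonneg : ∀ u, 0 ≤ u → 0 ≤ f u := by
    intro u hu
    by_cases h : ∃ n : ℕ, 1 ≤ n ∧ (2:ℝ) ^ n ≤ u ∧ u < (2:ℝ) ^ n + 1
    · rw [hf1 u h]; exact zero_le_one
    · rw [hf2 u hu h]; exact hu
  have hIone : ∀ n : ℕ, 1 ≤ n → ∀ b, (2:ℝ) ^ n ≤ b → b ≤ (2:ℝ) ^ n + 1 →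
      ∫ u in ((2:ℝ) ^ n)..b, Real.exp (-(s - u)) * f u
        = Real.exp (-(s - b)) - Real.exp (-(s - (2:ℝ) ^ n)) := by
    intro n hn b h1 h2
    rw [← integral_exp_neg_sub]
    refine intervalIntegral.integral_congr_Ioo_of_le h1 fun u hu => ?_
    simp [hf1 u ⟨n, hn, hu.1.le, hu.2.trans_le h2⟩]
  have hIid : ∀ n : ℕ, ∀ b, (2:ℝ) ^ n + 1 ≤ b → b ≤ (2:ℝ) ^ (n + 1) →
      ∫ u in ((2:ℝ) ^ n + 1)..b, Real.exp (-(s - u)) * f u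
        = Real.exp (-(s - b)) * (b - 1) - Real.exp (-(s - ((2:ℝ) ^ n + 1))) * (2:ℝ) ^ n := by
    intro n b h1 h2
    have h := integral_exp_neg_sub_mul_id s ((2:ℝ) ^ n + 1) b
    rw [add_sub_cancel_right] at h
    rw [← h]
    refine intervalIntegral.integral_congr_Ioo_of_le h1 fun u hu => ?_
    have hu0 : 0 ≤ u := le_trans (by positivity) hu.1.le
    simp only [hf2 u hu0 (not_mem_dyadic_window hu.1.le (hu.2.trans_le h2))]
  obtain ⟨n, hn1, hn2⟩ := exists_nat_pow_near (by linarith : (1:ℝ) ≤ s) one_lt_two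
  obtain ⟨j, rfl⟩ : ∃ j, n = j + 1 + 1 := by
    have : 2 < n + 1 := (pow_lt_pow_iff_right₀ (one_lt_two (α := ℝ))).1 (by linarith)
    exact ⟨n - 2, by omega⟩
  obtain ⟨m, hm⟩ : ∃ m, m = (2:ℝ) ^ (j + 1 + 1) := ⟨_, rfl⟩
  obtain ⟨k, hk⟩ : ∃ k, k = (2:ℝ) ^ (j + 1) := ⟨_, rfl⟩
  have hmk : m = 2 * k := by rw [hm, hk]; ring
  have hk2 : 2 ≤ k := by
    rw [hk, pow_succ]
    linarith [one_le_pow₀ (one_le_two (α := ℝ)) (n := j)]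
  have hA := hIid (j + 1) m (by rw [← hk]; linarith) hm.le
  have hB := hIone (j + 1 + 1) (by omega)
  have hC := hIid (j + 1 + 1) s
  rw [← hk] at hA
  rw [← hm] at hB hC hn1
  have h0 : 0 ≤ ∫ u in (0:ℝ)..(k + 1), Real.exp (-(s - u)) * f u :=
    intervalIntegral.integral_nonneg (by linarith)
      fun u hu => mul_nonneg (Real.exp_pos _).le (hnonneg u hu.1)
  have hlead : Real.exp (-(s - (k + 1))) * k ≤ Real.exp (-(s - m)) := by
    have h1 : Real.exp (-(s - m)) = Real.exp (-(s - (k + 1))) * Real.exp (k - 1) := by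
      rw [← Real.exp_add, hmk]; ring_nf
    rw [h1]
    have := Real.add_one_le_exp (k - 1)
    exact mul_le_mul_of_nonneg_left (by linarith) (Real.exp_pos _).le
  have hsplit : Λ s = (∫ u in (0:ℝ)..(k + 1), Real.exp (-(s - u)) * f u)
      + (∫ u in (k + 1)..m, Real.exp (-(s - u)) * f u)
      + ∫ u in m..s, Real.exp (-(s - u)) * f u := by
    rw [hΛ, intervalIntegral.integral_add_adjacent_intervals,
      intervalIntegral.integral_add_adjacent_intervals] <;>
    exact hint _ _ (by linarith) (by linarith)
  have he : 2 * Real.exp (-1) ≤ 1 := by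
    have h1 := Real.add_one_le_exp 1
    have h2 : Real.exp (-1) * Real.exp 1 = 1 := by rw [← Real.exp_add]; simp
    nlinarith [Real.exp_pos (-1)]
  have hepos := Real.exp_pos (-1)
  rcases le_total s (m + 1) with hsm | hsm
  · have hE : Real.exp (-1) ≤ Real.exp (-(s - m)) := Real.exp_le_exp.2 (by linarith)
    have hB' := hB s hn1 hsm
    rw [sub_self, neg_zero, Real.exp_zero] at hB'
    nlinarith [mul_nonneg (sub_nonneg.2 hE) (by linarith : 0 ≤ m - 3),
      mul_nonneg hepos.le (sub_nonneg.2 hsm)]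
  · have hB' := hB (m + 1) (by linarith) le_rfl
    have hC' := hC hsm hn2.le
    have hBC : ∫ u in m..s, Real.exp (-(s - u)) * f u
        = (∫ u in m..(m + 1), Real.exp (-(s - u)) * f u)
          + ∫ u in (m + 1)..s, Real.exp (-(s - u)) * f u := by
      rw [intervalIntegral.integral_add_adjacent_intervals] <;>
      exact hint _ _ (by linarith) (by linarith)
    rw [sub_self, neg_zero, Real.exp_zero] at hC'
    have hE1 : Real.exp (-(s - (m + 1))) ≤ 1 := Real.exp_le_one_iff.2 (by linarith)
    have hEm : Real.exp (-(s - m)) = Real.exp (-1) * Real.exp (-(s - (m + 1))) := by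
      rw [← Real.exp_add]; ring_nf
    rw [hEm] at hA hB' hlead
    set E := Real.exp (-(s - (m + 1)))
    set e := Real.exp (-1)
    have hcoef : 0 ≤ m - 1 - e * (m - 3) := by nlinarith
    have h1 := mul_nonneg (sub_nonneg.2 hE1) hcoef
    have h2 : 0 ≤ (1 - e) * (s - m - 1) := mul_nonneg (by linarith) (by linarith)
    nlinarith
end

section
/- Define f : [0,∞) → [0,∞) by f(t) = 1 if t ∈ [2ⁿ, 2ⁿ+1) for some integer n ≥ 1, and f(t) = t otherwise, and for t ≥ 0 set Λ(t) = ∫₀ᵗ e^{-(t-u)} f(u) du. Then ∫₀^∞ e^{-Λ(t)} f(t) dt < ∞ while ∫₀^∞ e^{-f(t)} f(t) dt = ∞. -/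
open MeasureTheory Real

/-- The union of the intervals `[2ⁿ, 2ⁿ+1)` over `n ≥ 1`. -/
def dyadicBlocks : Set ℝ := {t | ∃ n : ℕ, 1 ≤ n ∧ (2 : ℝ) ^ n ≤ t ∧ t < (2 : ℝ) ^ n + 1}

lemma dyadicBlocks_eq_iUnion :
    dyadicBlocks = ⋃ n : ℕ, Set.Ico ((2 : ℝ) ^ (n + 1)) ((2 : ℝ) ^ (n + 1) + 1) := by
  ext t
  simp only [dyadicBlocks, Set.mem_ofPred_eq, Set.mem_iUnion, Set.mem_Ico]
  constructor
  · rintro ⟨n, hn, h⟩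
    exact ⟨n - 1, by rwa [Nat.sub_add_cancel hn]⟩
  · rintro ⟨n, h⟩
    exact ⟨n + 1, by omega, h⟩

lemma measurableSet_dyadicBlocks : MeasurableSet dyadicBlocks := by
  rw [dyadicBlocks_eq_iUnion]
  exact MeasurableSet.iUnion fun _ => measurableSet_Ico

lemma two_le_of_mem_dyadicBlocks {t : ℝ} (ht : t ∈ dyadicBlocks) : 2 ≤ t := by
  obtain ⟨n, hn, h, -⟩ := ht
  have : (2 : ℝ) ^ 1 ≤ 2 ^ n := pow_le_pow_right₀ (by norm_num) hn
  linarith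

lemma two_pow_add_two_le {m n : ℕ} (hm : 1 ≤ m) (h : m < n) :
    (2 : ℝ) ^ m + 2 ≤ 2 ^ n := by
  have h1 : (2 : ℝ) ^ (m + 1) ≤ 2 ^ n := pow_le_pow_right₀ (by norm_num) h
  have h2 : (2 : ℝ) ^ 1 ≤ 2 ^ m := pow_le_pow_right₀ (by norm_num) hm
  rw [pow_succ] at h1
  linarith

lemma sub_one_notMem_dyadicBlocks {t : ℝ} (ht : t ∈ dyadicBlocks) : t - 1 ∉ dyadicBlocks := by
  rintro ⟨m, hm, h1, h2⟩
  obtain ⟨n, hn, h3, h4⟩ := ht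
  rcases lt_trichotomy m n with h | rfl | h
  · linarith [two_pow_add_two_le hm h]
  · linarith
  · linarith [two_pow_add_two_le hn h]

lemma volume_dyadicBlocks : volume dyadicBlocks = ⊤ := by
  rw [dyadicBlocks_eq_iUnion, measure_iUnion]
  · simp
  · intro i j hij
    refine Set.disjoint_left.2 fun t h1 h2 => ?_
    rw [Set.mem_Ico] at h1 h2
    rcases lt_or_gt_of_ne hij with h | h
    · linarith [two_pow_add_two_le (Nat.le_add_left 1 i) (Nat.add_lt_add_right h 1)]
    · linarith [two_pow_add_two_le (Nat.le_add_left 1 j) (Nat.add_lt_add_right h 1)]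
  · exact fun _ => measurableSet_Ico

lemma lintegral_exp_neg_mul_self_eq_top {f : ℝ → ℝ}
    (hf1 : ∀ t ∈ dyadicBlocks, f t = 1) :
    (∫⁻ t in Set.Ioi (0 : ℝ), ENNReal.ofReal (exp (-f t) * f t)) = ⊤ := by
  refine top_le_iff.1 ?_
  calc (⊤ : ENNReal)
      = ∫⁻ _ in dyadicBlocks, ENNReal.ofReal (exp (-1)) := by
        rw [setLIntegral_const, volume_dyadicBlocks, ENNReal.mul_top]
        simp [exp_pos]
    _ = ∫⁻ t in dyadicBlocks, ENNReal.ofReal (exp (-f t) * f t) :=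
        setLIntegral_congr_fun measurableSet_dyadicBlocks fun t ht => by simp [hf1 t ht]
    _ ≤ _ := lintegral_mono_set fun t ht => by
        have := two_le_of_mem_dyadicBlocks ht
        exact Set.mem_Ioi.2 (by linarith)

lemma intensity_nonneg {f : ℝ → ℝ}
    (hf1 : ∀ t ∈ dyadicBlocks, f t = 1)
    (hf2 : ∀ t, 0 ≤ t → t ∉ dyadicBlocks → f t = t)
    {t : ℝ} (ht : 0 ≤ t) : 0 ≤ f t := by
  by_cases h : t ∈ dyadicBlocks
  · simp [hf1 t h]
  · rwa [hf2 t ht h]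

lemma intensity_le_self {f : ℝ → ℝ}
    (hf1 : ∀ t ∈ dyadicBlocks, f t = 1)
    (hf2 : ∀ t, 0 ≤ t → t ∉ dyadicBlocks → f t = t)
    {t : ℝ} (ht : 0 ≤ t) : f t ≤ t := by
  by_cases h : t ∈ dyadicBlocks
  · linarith [hf1 t h, two_le_of_mem_dyadicBlocks h]
  · rw [hf2 t ht h]

lemma sub_one_le_intensity_add {f : ℝ → ℝ}
    (hf1 : ∀ t ∈ dyadicBlocks, f t = 1)
    (hf2 : ∀ t, 0 ≤ t → t ∉ dyadicBlocks → f t = t)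
    {t : ℝ} (ht : 1 ≤ t) : t - 1 ≤ f t + f (t - 1) := by
  have h0 := intensity_nonneg hf1 hf2 (zero_le_one.trans ht)
  have h1 := intensity_nonneg hf1 hf2 (sub_nonneg.2 ht)
  by_cases h : t ∈ dyadicBlocks
  · linarith [hf2 (t - 1) (sub_nonneg.2 ht) (sub_one_notMem_dyadicBlocks h)]
  · linarith [hf2 t (zero_le_one.trans ht) h]

lemma intervalIntegrable_intensity {f : ℝ → ℝ}
    (hf1 : ∀ t ∈ dyadicBlocks, f t = 1)
    (hf2 : ∀ t, 0 ≤ t → t ∉ dyadicBlocks → f t = t)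
    {a b : ℝ} (ha : 0 ≤ a) (hb : 0 ≤ b) :
    IntervalIntegrable f volume a b := by
  classical
  have hsub : Set.uIoc a b ⊆ Set.Ici 0 := fun t ht => by
    have := ht.1
    exact Set.mem_Ici.2 ((le_min ha hb).trans this.le)
  have hmeas : Measurable (dyadicBlocks.piecewise (fun _ => (1 : ℝ)) id) :=
    Measurable.piecewise measurableSet_dyadicBlocks measurable_const measurable_id
  refine (intervalIntegral.intervalIntegrable_id (μ := volume)).mono_fun
    (hmeas.aestronglyMeasurable.congr ?_) ?_
  · filter_upwards [ae_restrict_mem measurableSet_uIoc] with t ht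
    by_cases h : t ∈ dyadicBlocks
    · simp [h, hf1 t h]
    · simp [h, hf2 t (hsub ht) h]
  · filter_upwards [ae_restrict_mem measurableSet_uIoc] with t ht
    have h0 : 0 ≤ t := hsub ht
    simpa [abs_of_nonneg h0, abs_of_nonneg (intensity_nonneg hf1 hf2 h0)]
      using intensity_le_self hf1 hf2 h0

lemma sub_two_le_integral_intensity {f : ℝ → ℝ}
    (hf1 : ∀ t ∈ dyadicBlocks, f t = 1)
    (hf2 : ∀ t, 0 ≤ t → t ∉ dyadicBlocks → f t = t)
    {t : ℝ} (ht : 2 ≤ t) :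
    t - 2 ≤ ∫ u in (t - 2)..t, f u := by
  have hi : ∀ {a b : ℝ}, 0 ≤ a → 0 ≤ b → IntervalIntegrable f volume a b :=
    fun ha hb => intervalIntegrable_intensity hf1 hf2 ha hb
  have hshift : ∫ u in (t - 1)..t, f (u - 1) = ∫ u in (t - 2)..(t - 1), f u := by
    rw [intervalIntegral.integral_comp_sub_right]
    congr 1
    ring
  have hishift : IntervalIntegrable (fun u => f (u - 1)) volume (t - 1) t := by
    have := (hi (a := t - 2) (b := t - 1) (by linarith) (by linarith)).comp_sub_right 1
    convert this using 1 <;> ring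
  have h1 := hi (a := t - 1) (b := t) (by linarith) (by linarith)
  rw [← intervalIntegral.integral_add_adjacent_intervals
    (hi (a := t - 2) (b := t - 1) (by linarith) (by linarith)) h1, ← hshift, add_comm,
    ← intervalIntegral.integral_add h1 hishift]
  calc t - 2 = ∫ _ in (t - 1)..t, (t - 2) := by simp
    _ ≤ _ := intervalIntegral.integral_mono_on (by linarith) intervalIntegrable_const
        (h1.add hishift) fun u hu => by
          linarith [hu.1, sub_one_le_intensity_add hf1 hf2 (t := u) (by linarith [hu.1])]

lemma mul_sub_two_le_integral_exp_mul {f : ℝ → ℝ}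
    (hf1 : ∀ t ∈ dyadicBlocks, f t = 1)
    (hf2 : ∀ t, 0 ≤ t → t ∉ dyadicBlocks → f t = t)
    {t : ℝ} (ht : 0 ≤ t) :
    exp (-2) * (t - 2) ≤ ∫ u in (0 : ℝ)..t, exp (-(t - u)) * f u := by
  have hi : ∀ {a b : ℝ}, 0 ≤ a → 0 ≤ b →
      IntervalIntegrable (fun u => exp (-(t - u)) * f u) volume a b :=
    fun ha hb => (intervalIntegrable_intensity hf1 hf2 ha hb).continuousOn_mul (by fun_prop)
  have hnonneg : ∀ u, 0 ≤ u → 0 ≤ exp (-(t - u)) * f u :=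
    fun u hu => mul_nonneg (exp_pos _).le (intensity_nonneg hf1 hf2 hu)
  rcases le_total t 2 with h | h
  · exact (mul_nonpos_of_nonneg_of_nonpos (exp_pos _).le (by linarith)).trans
      (intervalIntegral.integral_nonneg ht fun u hu => hnonneg u hu.1)
  have h2 : 0 ≤ t - 2 := by linarith
  calc exp (-2) * (t - 2)
      ≤ exp (-2) * ∫ u in (t - 2)..t, f u :=
        mul_le_mul_of_nonneg_left (sub_two_le_integral_intensity hf1 hf2 h) (exp_pos _).le
    _ = ∫ u in (t - 2)..t, exp (-2) * f u := by rw [intervalIntegral.integral_const_mul]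
    _ ≤ ∫ u in (t - 2)..t, exp (-(t - u)) * f u :=
        intervalIntegral.integral_mono_on (by linarith)
          ((intervalIntegrable_intensity hf1 hf2 h2 ht).const_mul _) (hi h2 ht) fun u hu =>
            mul_le_mul_of_nonneg_right (exp_le_exp.2 (by linarith [hu.1]))
              (intensity_nonneg hf1 hf2 (h2.trans hu.1))
    _ ≤ ∫ u in (0 : ℝ)..t, exp (-(t - u)) * f u := by
        rw [← intervalIntegral.integral_add_adjacent_intervals (hi le_rfl h2) (hi h2 ht)]
        exact le_add_of_nonneg_left
          (intervalIntegral.integral_nonneg h2 fun u hu => hnonneg u hu.1)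

lemma lintegral_exp_neg_convolution_mul_lt_top {f : ℝ → ℝ}
    (hf1 : ∀ t ∈ dyadicBlocks, f t = 1)
    (hf2 : ∀ t, 0 ≤ t → t ∉ dyadicBlocks → f t = t) :
    (∫⁻ t in Set.Ioi (0 : ℝ),
      ENNReal.ofReal (exp (-∫ u in (0 : ℝ)..t, exp (-(t - u)) * f u) * f t)) < ⊤ := by
  have hint : IntegrableOn
      (fun t : ℝ => exp (2 * exp (-2)) * (t ^ (1 : ℝ) * exp (-exp (-2) * t ^ (1 : ℝ))))
      (Set.Ioi 0) :=
    (integrableOn_rpow_mul_exp_neg_mul_rpow (by norm_num) zero_lt_one (exp_pos _)).const_mul _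
  refine lt_of_le_of_lt (setLIntegral_mono' measurableSet_Ioi fun t ht => ?_)
    hint.lintegral_lt_top
  have ht0 : (0 : ℝ) ≤ t := le_of_lt ht
  refine ENNReal.ofReal_le_ofReal ?_
  calc _ ≤ exp (-(exp (-2) * (t - 2))) * t :=
        mul_le_mul (exp_le_exp.2 (neg_le_neg (mul_sub_two_le_integral_exp_mul hf1 hf2 ht0)))
          (intensity_le_self hf1 hf2 ht0) (intensity_nonneg hf1 hf2 ht0) (exp_pos _).le
    _ = _ := by
        rw [show -(exp (-2) * (t - 2)) = 2 * exp (-2) + -exp (-2) * t by ring, exp_add, rpow_one]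
        ring

/-- For the non-monotone intensity `f` equal to `1` on the intervals `[2ⁿ, 2ⁿ+1)` (`n ≥ 1`)
and equal to `t` elsewhere, with `Λ(t) = ∫₀ᵗ e^{-(t-u)} f(u) du`, one has
`∫₀^∞ e^{-Λ(t)} f(t) dt < ∞` while `∫₀^∞ e^{-f(t)} f(t) dt = ∞`. -/
theorem frog_counterexample_integrals (f Λ : ℝ → ℝ)
    (hf1 : ∀ t : ℝ, (∃ n : ℕ, 1 ≤ n ∧ (2:ℝ) ^ n ≤ t ∧ t < (2:ℝ) ^ n + 1) → f t = 1)
    (hf2 : ∀ t : ℝ, 0 ≤ t → (¬ ∃ n : ℕ, 1 ≤ n ∧ (2:ℝ) ^ n ≤ t ∧ t < (2:ℝ) ^ n + 1) → f t = t)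
    (hΛ : ∀ t, Λ t = ∫ u in (0:ℝ)..t, Real.exp (-(t - u)) * f u) :
    (∫⁻ t in Set.Ioi (0:ℝ), ENNReal.ofReal (Real.exp (-Λ t) * f t)) < ⊤ ∧
      (∫⁻ t in Set.Ioi (0:ℝ), ENNReal.ofReal (Real.exp (-f t) * f t)) = ⊤ := by
  obtain rfl : Λ = fun t => ∫ u in (0 : ℝ)..t, exp (-(t - u)) * f u := funext hΛ
  exact ⟨lintegral_exp_neg_convolution_mul_lt_top hf1 hf2,
    lintegral_exp_neg_mul_self_eq_top hf1⟩
end
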